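/- Let q be a real number with |q| < 1. Then S(q) = (4/3) Z(2)^2 - (1/3) Z(4) + (4/3) T(q), where S(q) = ∑_{i,j,k,ℓ ≥ 1, i+j = k+ℓ} q^{i+j} / ((1-q^i)(1-q^j)(1-q^k)(1-q^ℓ)) and T(q) = ∑_{i,j,k ≥ 1} q^{i+j+k} / ((1-q^i)(1-q^j)(1-q^k)(1-q^{i+j+k})). -/

import Mathlib

open scoped BigOperators

/-- Okounkov's `Z(2) = ∑_{n ≥ 1} qⁿ/(1-qⁿ)²`. -/
noncomputable def Z2 (q : ℝ) : ℝ := ∑' n : ℕ+, q ^ (n : ℕ) / (1 - q ^ (n : ℕ)) ^ 2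

/-- Okounkov's `Z(3) = ∑_{n ≥ 1} qⁿ(qⁿ+1)/(1-qⁿ)³`. -/
noncomputable def Z3 (q : ℝ) : ℝ :=
  ∑' n : ℕ+, q ^ (n : ℕ) * (q ^ (n : ℕ) + 1) / (1 - q ^ (n : ℕ)) ^ 3

/-- Okounkov's `Z(4) = ∑_{n ≥ 1} q²ⁿ/(1-qⁿ)⁴`. -/
noncomputable def Z4 (q : ℝ) : ℝ := ∑' n : ℕ+, q ^ (2 * (n : ℕ)) / (1 - q ^ (n : ℕ)) ^ 4

theorem hasSum_pnat_antidiagonal {F : ℕ → ℕ → ℝ}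
    (hF : Summable fun x : ℕ+ × ℕ+ => F x.1 x.2) :
    HasSum (fun n : ℕ+ => ∑ i ∈ Finset.Ico 1 (n : ℕ), F i (n - i))
      (∑' x : ℕ+ × ℕ+, F x.1 x.2) := by
  have key (n : ℕ+) : ∑' x : (fun x : ℕ+ × ℕ+ => x.1 + x.2) ⁻¹' {n}, F x.1.1 x.1.2 =
      ∑ i ∈ Finset.Ico 1 (n : ℕ), F i (n - i) := by
    have hpos (i : Finset.Ico 1 (n : ℕ)) : 0 < (i : ℕ) ∧ 0 < (n : ℕ) - i := by
      have := Finset.mem_Ico.1 i.2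
      omega
    let e : Finset.Ico 1 (n : ℕ) ≃ (fun x : ℕ+ × ℕ+ => x.1 + x.2) ⁻¹' {n} :=
      { toFun := fun i => ⟨(⟨i, (hpos i).1⟩, ⟨n - i, (hpos i).2⟩), by
          exact PNat.eq (Nat.add_sub_of_le (Finset.mem_Ico.1 i.2).2.le)⟩
        invFun := fun x => ⟨x.1.1, by
          have h : (x.1.1 + x.1.2 : ℕ) = n := by rw [← PNat.add_coe]; exact congrArg _ x.2
          have h1 := x.1.1.pos
          have h2 := x.1.2.pos
          rw [Finset.mem_Ico]
          omega⟩
        left_inv := fun i => rfl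
        right_inv := fun x => by
          have h : (x.1.1 + x.1.2 : ℕ) = n := by rw [← PNat.add_coe]; exact congrArg _ x.2
          refine Subtype.ext (Prod.ext rfl (PNat.eq ?_))
          simp only [PNat.mk_coe]
          omega }
    rw [← e.tsum_eq, ← Finset.tsum_subtype (Finset.Ico 1 (n : ℕ)) fun i => F i (n - i)]
    rfl
  simpa only [key] using hF.hasSum.tsum_fiberwise fun x : ℕ+ × ℕ+ => x.1 + x.2

theorem tsum_pnat_prod_of_symm {F : ℕ+ → ℕ+ → ℝ}
    (hF : Summable fun x : ℕ+ × ℕ+ => F x.1 x.2) (hsymm : ∀ i k, F i k = F k i) :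
    ∑' x : ℕ+ × ℕ+, F x.1 x.2 =
      ∑' i, F i i + 2 * ∑' x : ℕ+ × ℕ+, F (x.1 + x.2) x.1 := by
  let e : ℕ+ ⊕ ((ℕ+ × ℕ+) ⊕ (ℕ+ × ℕ+)) → ℕ+ × ℕ+ :=
    Sum.elim (fun i => (i, i))
      (Sum.elim (fun x => (x.1 + x.2, x.1)) fun x => (x.1, x.1 + x.2))
  have he : Function.Bijective e := by
    constructor
    · rintro (i | ⟨i, j⟩ | ⟨i, j⟩) (k | ⟨k, l⟩ | ⟨k, l⟩) h <;>
        simp only [e, Sum.elim_inl, Sum.elim_inr, Prod.mk.injEq, ← PNat.coe_inj,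
          PNat.add_coe] at h <;>
        have := i.pos <;> have := k.pos <;> try have := j.pos
      all_goals try have := l.pos
      all_goals first
        | omega
        | (simp only [Sum.inl.injEq, Sum.inr.injEq, Prod.mk.injEq, ← PNat.coe_inj]; omega)
    · rintro ⟨i, k⟩
      rcases lt_trichotomy i k with h | rfl | h
      · exact ⟨Sum.inr (Sum.inr (i, k - i)), Prod.ext rfl (PNat.add_sub_of_lt h)⟩
      · exact ⟨Sum.inl i, rfl⟩
      · exact ⟨Sum.inr (Sum.inl (k, i - k)), Prod.ext (PNat.add_sub_of_lt h) rfl⟩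
  have hs := (Equiv.ofBijective e he).summable_iff.2 hF
  rw [← (Equiv.ofBijective e he).tsum_eq]
  have hs' := hs.comp_injective Sum.inr_injective
  refine (Summable.tsum_sum (hs.comp_injective Sum.inl_injective) hs').trans ?_
  congr 1
  refine (Summable.tsum_sum (hs'.comp_injective Sum.inl_injective)
    (hs'.comp_injective Sum.inr_injective)).trans ?_
  rw [two_mul]
  congr 1
  exact tsum_congr fun x => hsymm _ _

theorem summable_pnat_pow {r : ℝ} (h0 : 0 ≤ r) (h1 : r < 1) :
    Summable fun n : ℕ+ => r ^ (n : ℕ) :=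
  (summable_geometric_of_lt_one h0 h1).comp_injective PNat.coe_injective

theorem summable_pnat_prod_pow {r : ℝ} (h0 : 0 ≤ r) (h1 : r < 1) :
    Summable fun x : ℕ+ × ℕ+ => r ^ ((x.1 : ℕ) + (x.2 : ℕ)) := by
  simp only [pow_add]
  exact (summable_pnat_pow h0 h1).mul_of_nonneg (summable_pnat_pow h0 h1)
    (fun _ => pow_nonneg h0 _) fun _ => pow_nonneg h0 _

/-- A geometric weight beats a factor of quadratic growth, at the cost of a square root. -/
theorem exists_abs_pow_mul_le {q : ℝ} (hq : |q| < 1) {u : ℕ → ℝ} {C : ℝ}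
    (hu : ∀ n, 0 < n → |u n| ≤ C * n ^ 2) :
    ∃ K : ℝ, ∀ n, 0 < n → |q ^ n * u n| ≤ K * √|q| ^ n := by
  have hr1 : √|q| < 1 := by rwa [Real.sqrt_lt' one_pos, one_pow]
  obtain ⟨K, hK⟩ := (tendsto_pow_const_mul_const_pow_of_abs_lt_one 2
    (by rwa [abs_of_nonneg (Real.sqrt_nonneg _)] : abs √|q| < 1)).bddAbove_range
  have hC : 0 ≤ C := by simpa using (abs_nonneg _).trans (hu 1 one_pos)
  refine ⟨C * K, fun n hn => ?_⟩
  have hsq : |q| ^ n = √|q| ^ n * √|q| ^ n := by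
    rw [← mul_pow, Real.mul_self_sqrt (abs_nonneg q)]
  rw [abs_mul, abs_pow, hsq]
  calc √|q| ^ n * √|q| ^ n * |u n| ≤ √|q| ^ n * √|q| ^ n * (C * n ^ 2) := by
        gcongr
        exact hu n hn
    _ = C * ((n : ℝ) ^ 2 * √|q| ^ n) * √|q| ^ n := by ring
    _ ≤ C * K * √|q| ^ n := by
        gcongr
        exact hK ⟨n, rfl⟩

theorem summable_pnat_prod_pow_mul {q : ℝ} (hq : |q| < 1) {u : ℕ → ℕ → ℝ} {C : ℝ}
    (hu : ∀ i j : ℕ, 0 < i → 0 < j → |u i j| ≤ C * (i + j : ℕ) ^ 2) :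
    Summable fun x : ℕ+ × ℕ+ => q ^ ((x.1 : ℕ) + (x.2 : ℕ)) * u x.1 x.2 := by
  have hC : 0 ≤ C := by
    have h := (abs_nonneg _).trans (hu 1 1 one_pos one_pos)
    norm_num at h
    exact h
  obtain ⟨K, hK⟩ := exists_abs_pow_mul_le (u := fun n => C * n ^ 2) hq
    fun n _ => (abs_of_nonneg (by positivity)).le
  have hr1 : √|q| < 1 := by rwa [Real.sqrt_lt' one_pos, one_pow]
  refine ((summable_pnat_prod_pow (Real.sqrt_nonneg _) hr1).mul_left K).of_norm_bounded
    fun x => le_trans ?_ (hK _ (Nat.add_pos_left x.1.pos _))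
  rw [Real.norm_eq_abs, abs_mul, abs_mul]
  exact mul_le_mul_of_nonneg_left ((hu _ _ x.1.pos x.2.pos).trans (le_abs_self _))
    (abs_nonneg _)

/-- The sum `1 / (1 - qⁿ)` of the geometric series in `qⁿ`. -/
noncomputable def geomInv (q : ℝ) (n : ℕ) : ℝ := 1 / (1 - q ^ n)

/-- The self-convolution of `geomInv q`. -/
noncomputable def geomConv (q : ℝ) (n : ℕ) : ℝ :=
  ∑ i ∈ Finset.Ico 1 n, geomInv q i * geomInv q (n - i)

/-- The weighted autocorrelation of `geomInv q`. -/
noncomputable def geomCorr (q : ℝ) (n : ℕ) : ℝ :=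
  ∑' k : ℕ+, q ^ (k : ℕ) * (geomInv q k * geomInv q (n + k))

theorem one_sub_abs_le {q : ℝ} (hq : |q| < 1) {n : ℕ} (hn : 0 < n) : 1 - |q| ≤ 1 - q ^ n := by
  have h : q ^ n ≤ |q| ^ 1 := (le_abs_self _).trans
    (by rw [abs_pow]; exact pow_le_pow_of_le_one (abs_nonneg q) hq.le hn)
  rw [pow_one] at h
  linarith

theorem one_sub_pow_ne_zero {q : ℝ} (hq : |q| < 1) {n : ℕ} (hn : 0 < n) : 1 - q ^ n ≠ 0 := by
  have := one_sub_abs_le hq hn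
  linarith

theorem abs_geomInv_le {q : ℝ} (hq : |q| < 1) {n : ℕ} (hn : 0 < n) : |geomInv q n| ≤ 1 / (1 - |q|) := by
  have h := one_sub_abs_le hq hn
  rw [geomInv, abs_of_nonneg (by apply one_div_nonneg.2; linarith)]
  exact one_div_le_one_div_of_le (by linarith) h

theorem one_le_geomInv_bound {q : ℝ} (hq : |q| < 1) : 1 ≤ 1 / (1 - |q|) := by
  rw [le_div_iff₀ (by linarith)]
  linarith [abs_nonneg q]

theorem pow_mul_geomInv {q : ℝ} (hq : |q| < 1) {n : ℕ} (hn : 0 < n) : q ^ n * geomInv q n = geomInv q n - 1 := by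
  have := one_sub_pow_ne_zero hq hn
  rw [geomInv]
  field_simp
  ring

theorem geomInv_mul_geomInv {q : ℝ} (hq : |q| < 1) {i j : ℕ} (hi : 0 < i) (hj : 0 < j) :
    geomInv q i * geomInv q j = geomInv q (i + j) * (geomInv q i + geomInv q j - 1) := by
  have h1 := one_sub_pow_ne_zero hq hi
  have h2 := one_sub_pow_ne_zero hq hj
  have h3 := one_sub_pow_ne_zero hq (Nat.add_pos_left hi j)
  rw [pow_add] at h3
  simp only [geomInv, pow_add]
  field_simp
  ring

theorem pow_mul_geomInv_mul_geomInv {q : ℝ} (hq : |q| < 1) {n k : ℕ} (hn : 0 < n) (hk : 0 < k) :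
    q ^ k * (geomInv q k * geomInv q (n + k)) =
      geomInv q n * (geomInv q k - geomInv q (n + k)) := by
  have h1 := one_sub_pow_ne_zero hq hn
  have h2 := one_sub_pow_ne_zero hq hk
  have h3 := one_sub_pow_ne_zero hq (Nat.add_pos_left hn k)
  rw [pow_add] at h3
  simp only [geomInv, pow_add]
  generalize q ^ n = x at *
  generalize q ^ k = y at *
  rw [mul_sub, one_div_mul_one_div, one_div_mul_one_div, one_div_mul_one_div, mul_one_div,
    div_sub_div _ _ (mul_ne_zero h1 h2) (mul_ne_zero h1 h3),
    div_eq_div_iff (mul_ne_zero h2 h3) (mul_ne_zero (mul_ne_zero h1 h2) (mul_ne_zero h1 h3))]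
  ring

theorem geomConv_eq {q : ℝ} (hq : |q| < 1) {n : ℕ} (hn : 0 < n) :
    geomConv q n = geomInv q n * (2 * ∑ i ∈ Finset.Ico 1 n, geomInv q i - (n - 1)) := by
  have hrefl : ∑ i ∈ Finset.Ico 1 n, geomInv q (n - i) = ∑ i ∈ Finset.Ico 1 n, geomInv q i := by
    rw [Finset.sum_Ico_reflect _ _ (Nat.le_succ n)]
    simp
  have hterm : ∀ i ∈ Finset.Ico 1 n, geomInv q i * geomInv q (n - i) =
      geomInv q n * (geomInv q i + geomInv q (n - i) - 1) := fun i hi => by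
    obtain ⟨h1, h2⟩ := Finset.mem_Ico.1 hi
    rw [geomInv_mul_geomInv hq h1 (Nat.sub_pos_of_lt h2), Nat.add_sub_of_le h2.le]
  rw [geomConv, Finset.sum_congr rfl hterm, ← Finset.mul_sum, Finset.sum_sub_distrib,
    Finset.sum_add_distrib, hrefl, Finset.sum_const, Nat.card_Ico, nsmul_eq_mul,
    Nat.cast_pred hn]
  ring

theorem geomCorr_eq {q : ℝ} (hq : |q| < 1) {n : ℕ} (hn : 0 < n) :
    geomCorr q n = geomInv q n * (∑ i ∈ Finset.Ico 1 n, geomInv q i + geomInv q n - n) := by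
  have hb (k : ℕ) : q ^ (k + 1) * geomInv q (k + 1) = geomInv q (k + 1) - 1 :=
    pow_mul_geomInv hq k.succ_pos
  have hs : Summable fun k : ℕ => geomInv q (k + 1) - 1 := by
    simp only [← hb]
    refine ((summable_geometric_of_lt_one (abs_nonneg q) hq).mul_right
      (1 / (1 - |q|))).of_norm_bounded fun k => ?_
    rw [Real.norm_eq_abs, abs_mul, abs_pow]
    exact mul_le_mul (pow_le_pow_of_le_one (abs_nonneg q) hq.le k.le_succ)
      (abs_geomInv_le hq k.succ_pos) (abs_nonneg _) (pow_nonneg (abs_nonneg q) _)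
  have hsum := hs.sum_add_tsum_nat_add n
  have hsplit : ∑ k ∈ Finset.range n, (geomInv q (k + 1) - 1) =
      ∑ i ∈ Finset.Ico 1 n, geomInv q i + geomInv q n - n := by
    obtain ⟨m, rfl⟩ := Nat.exists_eq_add_one.2 hn
    rw [Finset.sum_sub_distrib, Finset.sum_range_succ, Finset.sum_Ico_eq_sum_range]
    simp [add_comm]
  have hcorr : geomCorr q n = ∑' k : ℕ, geomInv q n *
      ((geomInv q (k + 1) - 1) - (geomInv q (k + n + 1) - 1)) := by
    rw [geomCorr, tsum_pnat_eq_tsum_succ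
      (f := fun k => q ^ k * (geomInv q k * geomInv q (n + k)))]
    refine tsum_congr fun k => ?_
    rw [pow_mul_geomInv_mul_geomInv hq hn k.succ_pos, show n + (k + 1) = k + n + 1 by ring]
    ring
  rw [hcorr, tsum_mul_left, hs.tsum_sub ((summable_nat_add_iff n).2 hs), ← hsplit, ← hsum]
  ring

theorem geomConv_sub_geomCorr {q : ℝ} (hq : |q| < 1) {n : ℕ} (hn : 0 < n) :
    geomConv q n - 2 * geomCorr q n = geomInv q n * (n + 1 - 2 * geomInv q n) := by
  rw [geomConv_eq hq hn, geomCorr_eq hq hn]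
  ring

theorem abs_geomConv_le {q : ℝ} (hq : |q| < 1) {n : ℕ} (hn : 0 < n) :
    |geomConv q n| ≤ (1 / (1 - |q|)) ^ 2 * n := by
  have hterm : ∀ i ∈ Finset.Ico 1 n, |geomInv q i * geomInv q (n - i)| ≤ (1 / (1 - |q|)) ^ 2 :=
    fun i hi => by
      obtain ⟨h1, h2⟩ := Finset.mem_Ico.1 hi
      rw [abs_mul, sq]
      exact mul_le_mul (abs_geomInv_le hq h1) (abs_geomInv_le hq (Nat.sub_pos_of_lt h2))
        (abs_nonneg _) (zero_le_one.trans (one_le_geomInv_bound hq))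
  refine ((Finset.abs_sum_le_sum_abs _ _).trans (Finset.sum_le_card_nsmul _ _ _ hterm)).trans ?_
  rw [Nat.card_Ico, nsmul_eq_mul, Nat.cast_pred hn, mul_comm]
  exact mul_le_mul_of_nonneg_left (by linarith) (sq_nonneg _)

theorem abs_geomCorr_le {q : ℝ} (hq : |q| < 1) {n : ℕ} (hn : 0 < n) :
    |geomCorr q n| ≤ 3 * (1 / (1 - |q|)) ^ 2 * n := by
  have hM := one_le_geomInv_bound hq
  have hn' : (1 : ℝ) ≤ n := by exact_mod_cast hn
  have hd : geomCorr q n = (geomConv q n - geomInv q n * (n + 1 - 2 * geomInv q n)) / 2 := by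
    rw [← geomConv_sub_geomCorr hq hn]
    ring
  have hc := abs_le.1 (abs_geomConv_le hq hn)
  have ha := abs_geomInv_le hq hn
  set M := 1 / (1 - |q|)
  have hφ : |geomInv q n * (n + 1 - 2 * geomInv q n)| ≤ M * (4 * (M * n)) := by
    rw [abs_mul]
    have ha' := abs_le.1 ha
    refine mul_le_mul ha (abs_le.2 ⟨?_, ?_⟩) (abs_nonneg _) (by linarith) <;> nlinarith
  have hφ' := abs_le.1 hφ
  rw [hd, abs_le]
  constructor <;> nlinarith

theorem abs_weight_mul_geomInv_le {q : ℝ} (hq : |q| < 1) {w : ℕ → ℝ} {B : ℝ}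
    (hw : ∀ n, 0 < n → |w n| ≤ B * n) {m n i j : ℕ} (hm : 0 < m) (hmn : m ≤ n) (hi : 0 < i)
    (hj : 0 < j) :
    |w m * (geomInv q i * geomInv q j)| ≤ B * (1 / (1 - |q|)) ^ 2 * n ^ 2 := by
  have hB : 0 ≤ B := by simpa using (abs_nonneg _).trans (hw 1 one_pos)
  have hM := one_le_geomInv_bound hq
  have hi' := abs_geomInv_le hq hi
  have hj' := abs_geomInv_le hq hj
  have hmn' : (m : ℝ) ≤ n ^ 2 := by exact_mod_cast hmn.trans (Nat.le_self_pow two_ne_zero n)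
  rw [abs_mul, abs_mul]
  set M := 1 / (1 - |q|)
  calc |w m| * (|geomInv q i| * |geomInv q j|) ≤ (B * m) * (M * M) := by
        gcongr
        exact hw m hm
    _ = B * M ^ 2 * m := by ring
    _ ≤ B * M ^ 2 * n ^ 2 := by gcongr

theorem summable_geomConv_weight {q : ℝ} (hq : |q| < 1) {w : ℕ → ℝ} {B : ℝ}
    (hw : ∀ n, 0 < n → |w n| ≤ B * n) :
    Summable fun x : ℕ+ × ℕ+ => q ^ ((x.1 : ℕ) + (x.2 : ℕ)) *
      (w ((x.1 : ℕ) + (x.2 : ℕ)) * (geomInv q x.1 * geomInv q x.2)) :=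
  summable_pnat_prod_pow_mul (u := fun i j => w (i + j) * (geomInv q i * geomInv q j)) hq
    fun _ _ hi hj => abs_weight_mul_geomInv_le hq hw (Nat.add_pos_left hi _) le_rfl hi hj

theorem summable_geomCorr_weight {q : ℝ} (hq : |q| < 1) {w : ℕ → ℝ} {B : ℝ}
    (hw : ∀ n, 0 < n → |w n| ≤ B * n) :
    Summable fun x : ℕ+ × ℕ+ => q ^ ((x.1 : ℕ) + (x.2 : ℕ)) *
      (w x.1 * (geomInv q x.2 * geomInv q ((x.1 : ℕ) + (x.2 : ℕ)))) :=
  summable_pnat_prod_pow_mul (u := fun i j => w i * (geomInv q j * geomInv q (i + j))) hq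
    fun _ _ hi hj =>
      abs_weight_mul_geomInv_le hq hw hi (Nat.le_add_right _ _) hj (Nat.add_pos_left hi _)

theorem hasSum_geomConv_weight {q : ℝ} (hq : |q| < 1) {w : ℕ → ℝ} {B : ℝ}
    (hw : ∀ n, 0 < n → |w n| ≤ B * n) :
    HasSum (fun n : ℕ+ => q ^ (n : ℕ) * (w n * geomConv q n))
      (∑' x : ℕ+ × ℕ+, q ^ ((x.1 : ℕ) + (x.2 : ℕ)) *
        (w ((x.1 : ℕ) + (x.2 : ℕ)) * (geomInv q x.1 * geomInv q x.2))) := by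
  have h := hasSum_pnat_antidiagonal
    (F := fun i j => q ^ (i + j) * (w (i + j) * (geomInv q i * geomInv q j)))
    (summable_geomConv_weight hq hw)
  have key (n : ℕ+) : ∑ i ∈ Finset.Ico 1 (n : ℕ), q ^ (i + (n - i)) *
      (w (i + (n - i)) * (geomInv q i * geomInv q (n - i))) =
      q ^ (n : ℕ) * (w n * geomConv q n) := by
    rw [geomConv, Finset.mul_sum, Finset.mul_sum]
    refine Finset.sum_congr rfl fun i hi => ?_
    rw [Nat.add_sub_of_le (Finset.mem_Ico.1 hi).2.le]
  simpa only [key] using h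

theorem hasSum_geomCorr_weight {q : ℝ} (hq : |q| < 1) {w : ℕ → ℝ} {B : ℝ}
    (hw : ∀ n, 0 < n → |w n| ≤ B * n) :
    HasSum (fun n : ℕ+ => q ^ (n : ℕ) * (w n * geomCorr q n))
      (∑' x : ℕ+ × ℕ+, q ^ ((x.1 : ℕ) + (x.2 : ℕ)) *
        (w x.1 * (geomInv q x.2 * geomInv q ((x.1 : ℕ) + (x.2 : ℕ))))) := by
  have hs := summable_geomCorr_weight hq hw
  have key (n : ℕ+) : ∑' k : ℕ+, q ^ ((n : ℕ) + (k : ℕ)) *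
      (w n * (geomInv q k * geomInv q ((n : ℕ) + (k : ℕ)))) =
      q ^ (n : ℕ) * (w n * geomCorr q n) := by
    rw [geomCorr, ← tsum_mul_left, ← tsum_mul_left]
    refine tsum_congr fun k => ?_
    rw [pow_add]
    ring
  have h := hs.prod.hasSum
  rw [← hs.tsum_prod] at h
  simpa only [key] using h

theorem summable_pow_mul_geomInv_sq {q : ℝ} (hq : |q| < 1) :
    Summable fun n : ℕ+ => q ^ (n : ℕ) * geomInv q n ^ 2 := by
  refine ((summable_pnat_pow (abs_nonneg q) hq).mul_right
    ((1 / (1 - |q|)) ^ 2)).of_norm_bounded fun n => ?_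
  rw [Real.norm_eq_abs, abs_mul, abs_pow, abs_pow]
  gcongr
  exact abs_geomInv_le hq n.pos

theorem summable_pow_mul_geomInv_sq_mul {q : ℝ} (hq : |q| < 1) :
    Summable fun x : ℕ+ × ℕ+ =>
      q ^ (x.1 : ℕ) * geomInv q x.1 ^ 2 * (q ^ (x.2 : ℕ) * geomInv q x.2 ^ 2) :=
  summable_mul_of_summable_norm (summable_pow_mul_geomInv_sq hq).norm
    (summable_pow_mul_geomInv_sq hq).norm

theorem Z2_eq_tsum_geomInv {q : ℝ} : Z2 q = ∑' n : ℕ+, q ^ (n : ℕ) * geomInv q n ^ 2 :=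
  tsum_congr fun n => by rw [geomInv, div_pow, one_pow, mul_one_div]

theorem Z4_eq_tsum_geomInv {q : ℝ} :
    Z4 q = ∑' n : ℕ+, q ^ (n : ℕ) * geomInv q n ^ 2 * (q ^ (n : ℕ) * geomInv q n ^ 2) :=
  tsum_congr fun n => by
    rw [geomInv, div_pow, one_pow, mul_one_div, div_mul_div_comm, ← pow_add, ← pow_add, two_mul]

theorem Z2_sq_eq_tsum_prod {q : ℝ} (hq : |q| < 1) :
    Z2 q ^ 2 = ∑' x : ℕ+ × ℕ+,
      q ^ (x.1 : ℕ) * geomInv q x.1 ^ 2 * (q ^ (x.2 : ℕ) * geomInv q x.2 ^ 2) := by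
  have hs := summable_pow_mul_geomInv_sq hq
  rw [sq, Z2_eq_tsum_geomInv, hs.tsum_mul_tsum hs (summable_pow_mul_geomInv_sq_mul hq)]

theorem abs_geomInv_mul_sub_half_le {q : ℝ} (hq : |q| < 1) {n : ℕ} (hn : 0 < n) :
    |geomInv q n * (geomInv q n - 1 / 2)| ≤ 2 * (1 / (1 - |q|)) ^ 2 * n := by
  have hM := one_le_geomInv_bound hq
  have ha := abs_geomInv_le hq hn
  have hn' : (1 : ℝ) ≤ n := by exact_mod_cast hn
  set M := 1 / (1 - |q|)
  have ha' := abs_le.1 ha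
  have hb : |geomInv q n - 1 / 2| ≤ 2 * M := abs_le.2 ⟨by linarith, by linarith⟩
  rw [abs_mul]
  calc |geomInv q n| * |geomInv q n - 1 / 2| ≤ M * (2 * M) := by gcongr
    _ = 2 * M ^ 2 * 1 := by ring
    _ ≤ 2 * M ^ 2 * n := by gcongr

theorem abs_mul_geomInv_le {q : ℝ} (hq : |q| < 1) {n : ℕ} (hn : 0 < n) :
    |n * geomInv q n| ≤ 1 / (1 - |q|) * n := by
  rw [abs_mul, Nat.abs_cast, mul_comm]
  exact mul_le_mul_of_nonneg_right (abs_geomInv_le hq hn) n.cast_nonneg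

theorem two_mul_tsum_geomConv_eq_Z4 {q : ℝ} (hq : |q| < 1) :
    2 * ∑' n : ℕ+, q ^ (n : ℕ) * (geomInv q n * (geomInv q n - 1 / 2) * geomConv q n) = Z4 q := by
  have hw := fun n (hn : 0 < n) => abs_geomInv_mul_sub_half_le hq hn
  have hpp := summable_pow_mul_geomInv_sq_mul hq
  have hsymm := tsum_pnat_prod_of_symm
    (F := fun i j => q ^ (i : ℕ) * geomInv q i ^ 2 * (q ^ (j : ℕ) * geomInv q j ^ 2)) hpp
    fun _ _ => mul_comm _ _
  have hinj : Function.Injective fun x : ℕ+ × ℕ+ => (x.1 + x.2, x.1) := by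
    rintro ⟨i, j⟩ ⟨k, l⟩ h
    obtain ⟨h1, rfl⟩ := Prod.mk.inj h
    exact Prod.ext rfl (add_left_cancel h1)
  have hs1 := hpp.comp_injective hinj
  have hs2 := (Equiv.prodComm ℕ+ ℕ+).summable_iff.2 hs1
  have hswap := (Equiv.prodComm ℕ+ ℕ+).tsum_eq
    ((fun x : ℕ+ × ℕ+ => q ^ (x.1 : ℕ) * geomInv q x.1 ^ 2 * (q ^ (x.2 : ℕ) * geomInv q x.2 ^ 2)) ∘
      fun x : ℕ+ × ℕ+ => (x.1 + x.2, x.1))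
  have hexp := (hs1.hasSum.add hs2.hasSum).add
    ((summable_geomConv_weight hq hw).hasSum.mul_left 2)
  have hterm : ∀ x : ℕ+ × ℕ+,
      q ^ (x.1 : ℕ) * geomInv q x.1 ^ 2 * (q ^ (x.2 : ℕ) * geomInv q x.2 ^ 2) =
      q ^ ((x.1 + x.2 : ℕ+) : ℕ) * geomInv q ((x.1 + x.2 : ℕ+) : ℕ) ^ 2 *
          (q ^ (x.1 : ℕ) * geomInv q x.1 ^ 2) +
        q ^ ((x.2 + x.1 : ℕ+) : ℕ) * geomInv q ((x.2 + x.1 : ℕ+) : ℕ) ^ 2 *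
          (q ^ (x.2 : ℕ) * geomInv q x.2 ^ 2) +
        2 * (q ^ ((x.1 : ℕ) + (x.2 : ℕ)) *
          (geomInv q ((x.1 : ℕ) + (x.2 : ℕ)) * (geomInv q ((x.1 : ℕ) + (x.2 : ℕ)) - 1 / 2) *
            (geomInv q x.1 * geomInv q x.2))) := by
    rintro ⟨i, j⟩
    have h1 := one_sub_pow_ne_zero hq i.pos
    have h2 := one_sub_pow_ne_zero hq j.pos
    have h3 := one_sub_pow_ne_zero hq (i + j).pos
    rw [PNat.add_coe, pow_add] at h3
    simp only [geomInv, PNat.add_coe, pow_add, mul_comm (q ^ (j : ℕ)) (q ^ (i : ℕ))]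
    generalize q ^ (i : ℕ) = x at *
    generalize q ^ (j : ℕ) = y at *
    field_simp
    ring
  have hval := (tsum_congr hterm).trans hexp.tsum_eq
  have hconv := (hasSum_geomConv_weight hq hw).tsum_eq
  rw [Z4_eq_tsum_geomInv, hconv]
  simp only [Function.comp_def, Equiv.prodComm_apply, Prod.fst_swap, Prod.snd_swap] at *
  linarith

theorem two_mul_tsum_geomCorr_eq_Z2_sq {q : ℝ} (hq : |q| < 1) :
    2 * ∑' n : ℕ+, q ^ (n : ℕ) * (geomInv q n * (geomInv q n - 1 / 2) * geomCorr q n) =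
      Z2 q ^ 2 := by
  have hw := fun n (hn : 0 < n) => abs_geomInv_mul_sub_half_le hq hn
  have hs := summable_geomCorr_weight hq hw
  have hs' := (Equiv.prodComm ℕ+ ℕ+).summable_iff.2 hs
  rw [(hasSum_geomCorr_weight hq hw).tsum_eq, Z2_sq_eq_tsum_prod hq, two_mul]
  nth_rewrite 2 [← (Equiv.prodComm ℕ+ ℕ+).tsum_eq]
  refine (hs.tsum_add hs').symm.trans (tsum_congr ?_)
  rintro ⟨i, j⟩
  simp only [Function.comp_apply, Equiv.prodComm_apply, Prod.swap_prod_mk]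
  have h := geomInv_mul_geomInv hq i.pos j.pos
  rw [add_comm (j : ℕ) i, pow_add]
  linear_combination -q ^ (i : ℕ) * q ^ (j : ℕ) * (geomInv q i * geomInv q j) * h

theorem tsum_mul_geomConv_eq_two_mul_tsum_geomCorr {q : ℝ} (hq : |q| < 1) :
    ∑' n : ℕ+, q ^ (n : ℕ) * (n * geomInv q n * geomConv q n) =
      2 * ∑' n : ℕ+, q ^ (n : ℕ) * (n * geomInv q n * geomCorr q n) := by
  have hw := fun n (hn : 0 < n) => abs_mul_geomInv_le hq hn
  have hs := summable_geomCorr_weight hq hw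
  have hs' := (Equiv.prodComm ℕ+ ℕ+).summable_iff.2 hs
  rw [(hasSum_geomCorr_weight hq hw).tsum_eq, (hasSum_geomConv_weight hq hw).tsum_eq, two_mul]
  nth_rewrite 3 [← (Equiv.prodComm ℕ+ ℕ+).tsum_eq]
  refine Eq.trans (tsum_congr ?_) (hs.tsum_add hs')
  rintro ⟨i, j⟩
  simp only [Equiv.prodComm_apply, Prod.swap_prod_mk]
  rw [add_comm (j : ℕ) i]
  push_cast
  ring

/-- The summand of `S q` at `((i, j), (k, l))`. -/
noncomputable def quadTerm (q : ℝ) (x : (ℕ+ × ℕ+) × (ℕ+ × ℕ+)) : ℝ :=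
  if (x.1.1 : ℕ) + (x.1.2 : ℕ) = (x.2.1 : ℕ) + (x.2.2 : ℕ) then
    q ^ ((x.1.1 : ℕ) + (x.1.2 : ℕ)) / ((1 - q ^ (x.1.1 : ℕ)) * (1 - q ^ (x.1.2 : ℕ)) *
      (1 - q ^ (x.2.1 : ℕ)) * (1 - q ^ (x.2.2 : ℕ)))
  else 0

theorem quadTerm_of_eq {q : ℝ} {i j k l : ℕ+} (h : (i : ℕ) + (j : ℕ) = (k : ℕ) + (l : ℕ)) :
    quadTerm q ((i, j), (k, l)) =
      q ^ ((i : ℕ) + (j : ℕ)) * (geomInv q i * geomInv q j * (geomInv q k * geomInv q l)) := by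
  rw [quadTerm, if_pos h]
  simp only [geomInv, div_eq_mul_inv, mul_inv, one_mul, mul_assoc]

theorem summable_quadTerm {q : ℝ} (hq : |q| < 1) : Summable (quadTerm q) := by
  have hr1 : √|q| < 1 := by rwa [Real.sqrt_lt' one_pos, one_pow]
  have hr := summable_pnat_prod_pow (Real.sqrt_nonneg |q|) hr1
  have hM := one_le_geomInv_bound hq
  refine ((hr.mul_of_nonneg hr (fun _ => by positivity) fun _ => by positivity).mul_left
    ((1 / (1 - |q|)) ^ 4)).of_norm_bounded ?_
  rintro ⟨⟨i, j⟩, k, l⟩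
  by_cases h : (i : ℕ) + (j : ℕ) = (k : ℕ) + (l : ℕ)
  · rw [quadTerm_of_eq h, Real.norm_eq_abs, abs_mul, abs_mul, abs_mul, abs_mul, abs_pow, ← h,
      ← mul_pow, Real.mul_self_sqrt (abs_nonneg q), mul_comm]
    have hi := abs_geomInv_le hq i.pos
    have hj := abs_geomInv_le hq j.pos
    have hk := abs_geomInv_le hq k.pos
    have hl := abs_geomInv_le hq l.pos
    set M := 1 / (1 - |q|)
    refine mul_le_mul_of_nonneg_right ?_ (by positivity)
    calc _ ≤ M * M * (M * M) := by gcongr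
      _ = M ^ 4 := by ring
  · rw [quadTerm, if_neg h, norm_zero]
    positivity

theorem tsum_quadTerm_right {q : ℝ} (hq : |q| < 1) (i j : ℕ+) :
    ∑' y : ℕ+ × ℕ+, quadTerm q ((i, j), y) = q ^ ((i : ℕ) + (j : ℕ)) *
      (geomConv q ((i : ℕ) + (j : ℕ)) * (geomInv q i * geomInv q j)) := by
  have h := (hasSum_pnat_antidiagonal
    (F := fun k l => if (i : ℕ) + (j : ℕ) = k + l then q ^ ((i : ℕ) + (j : ℕ)) /
      ((1 - q ^ (i : ℕ)) * (1 - q ^ (j : ℕ)) * (1 - q ^ k) * (1 - q ^ l)) else 0)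
    ((summable_quadTerm hq).prod_factor (i, j))).tsum_eq
  refine h.symm.trans ((tsum_eq_single (i + j) fun n hn => ?_).trans ?_)
  · refine Finset.sum_eq_zero fun k hk => if_neg fun h => hn (PNat.eq ?_)
    rw [PNat.add_coe, h, Nat.add_sub_of_le (Finset.mem_Ico.1 hk).2.le]
  · rw [geomConv, PNat.add_coe, Finset.sum_mul, Finset.mul_sum]
    refine Finset.sum_congr rfl fun k hk => ?_
    rw [if_pos (Nat.add_sub_of_le (Finset.mem_Ico.1 hk).2.le).symm]
    simp only [geomInv, div_eq_mul_inv, mul_inv]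
    ring

theorem tsum_quadTerm_eq_geomConv {q : ℝ} (hq : |q| < 1) :
    ∑' x, quadTerm q x = ∑' n : ℕ+, q ^ (n : ℕ) * (geomConv q n * geomConv q n) := by
  rw [(hasSum_geomConv_weight hq fun n hn => abs_geomConv_le hq hn).tsum_eq,
    (summable_quadTerm hq).tsum_prod]
  exact tsum_congr fun x => tsum_quadTerm_right hq x.1 x.2

theorem tsum_quadTerm_eq_geomCorr {q : ℝ} (hq : |q| < 1) :
    ∑' x, quadTerm q x = Z2 q ^ 2 +
      2 * ∑' n : ℕ+, q ^ (n : ℕ) * (geomCorr q n * geomCorr q n) := by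
  have hs := (Equiv.prodProdProdComm ℕ+ ℕ+ ℕ+ ℕ+).summable_iff.2 (summable_quadTerm hq)
  have hslice (i k : ℕ+) : Summable fun y : ℕ+ × ℕ+ => quadTerm q ((i, y.1), (k, y.2)) :=
    hs.prod_factor (i, k)
  have hdiag (i : ℕ+) : ∑' y : ℕ+ × ℕ+, quadTerm q ((i, y.1), (i, y.2)) =
      q ^ (i : ℕ) * geomInv q i ^ 2 * Z2 q := by
    rw [(hslice i i).tsum_prod, Z2_eq_tsum_geomInv, ← tsum_mul_left]
    refine tsum_congr fun j => (tsum_eq_single j fun l hl => if_neg fun h => hl ?_).trans ?_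
    · exact PNat.eq (Nat.add_left_cancel h).symm
    · refine (quadTerm_of_eq rfl).trans ?_
      rw [pow_add]
      ring
  have hoff (k m : ℕ+) : ∑' y : ℕ+ × ℕ+, quadTerm q ((k + m, y.1), (k, y.2)) =
      q ^ ((m : ℕ) + (k : ℕ)) *
        (geomCorr q m * (geomInv q k * geomInv q ((m : ℕ) + (k : ℕ)))) := by
    rw [(hslice (k + m) k).tsum_prod, geomCorr, ← tsum_mul_right, ← tsum_mul_left]
    refine tsum_congr fun j => (tsum_eq_single (m + j) fun l hl => if_neg fun h => hl ?_).trans ?_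
    · refine PNat.eq (Nat.add_left_cancel (n := k) ?_)
      rw [← h, PNat.add_coe, PNat.add_coe, add_assoc]
    · refine (quadTerm_of_eq (by simp only [PNat.add_coe]; ring)).trans ?_
      rw [PNat.add_coe, PNat.add_coe,
        add_comm (k : ℕ) m, pow_add]
      ring
  have hsymm (i k : ℕ+) : ∑' y : ℕ+ × ℕ+, quadTerm q ((i, y.1), (k, y.2)) =
      ∑' y : ℕ+ × ℕ+, quadTerm q ((k, y.1), (i, y.2)) := by
    rw [← (Equiv.prodComm ℕ+ ℕ+).tsum_eq]
    refine tsum_congr fun y => ?_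
    by_cases h : (i : ℕ) + (y.2 : ℕ) = (k : ℕ) + (y.1 : ℕ)
    · refine (quadTerm_of_eq h).trans ((quadTerm_of_eq h.symm).trans ?_).symm
      rw [h, mul_comm (geomInv q i * _)]
    · exact (if_neg h).trans (if_neg (Ne.symm h)).symm
  rw [(hasSum_geomCorr_weight hq fun n hn => abs_geomCorr_le hq hn).tsum_eq,
    ← (Equiv.prodProdProdComm ℕ+ ℕ+ ℕ+ ℕ+).tsum_eq]
  refine (hs.tsum_prod.trans (tsum_pnat_prod_of_symm hs.prod hsymm)).trans ?_
  congr 1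
  · rw [tsum_congr hdiag, tsum_mul_right, ← Z2_eq_tsum_geomInv, sq]
  · rw [← (Equiv.prodComm ℕ+ ℕ+).tsum_eq]
    exact congrArg (2 * ·) (tsum_congr fun x => hoff x.2 x.1)

theorem tsum_triple_eq {q : ℝ} (hq : |q| < 1) :
    (∑' i : ℕ+, ∑' j : ℕ+, ∑' k : ℕ+, q ^ ((i : ℕ) + (j : ℕ) + (k : ℕ)) /
      ((1 - q ^ (i : ℕ)) * (1 - q ^ (j : ℕ)) * (1 - q ^ (k : ℕ)) *
        (1 - q ^ ((i : ℕ) + (j : ℕ) + (k : ℕ))))) =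
      ∑' n : ℕ+, q ^ (n : ℕ) * (geomCorr q n * geomConv q n) := by
  have hw := fun n (hn : 0 < n) => abs_geomCorr_le hq hn
  rw [(hasSum_geomConv_weight hq hw).tsum_eq, (summable_geomConv_weight hq hw).tsum_prod]
  refine tsum_congr fun i => tsum_congr fun j => ?_
  rw [geomCorr, ← tsum_mul_right, ← tsum_mul_left]
  refine tsum_congr fun k => ?_
  simp only [geomInv, div_eq_mul_inv, mul_inv, pow_add]
  ring

theorem tsum_geomConv_sub_sq {q : ℝ} (hq : |q| < 1) :
    ∑' n : ℕ+, q ^ (n : ℕ) * (geomConv q n * geomConv q n) -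
      4 * ∑' n : ℕ+, q ^ (n : ℕ) * (geomCorr q n * geomConv q n) +
      4 * ∑' n : ℕ+, q ^ (n : ℕ) * (geomCorr q n * geomCorr q n) =
      2 * Z2 q ^ 2 - Z4 q := by
  have hconv := fun n (hn : 0 < n) => abs_geomConv_le hq hn
  have hcorr := fun n (hn : 0 < n) => abs_geomCorr_le hq hn
  have hlin := fun n (hn : 0 < n) => abs_mul_geomInv_le hq hn
  have hhalf := fun n (hn : 0 < n) => abs_geomInv_mul_sub_half_le hq hn
  have s1 := (hasSum_geomConv_weight hq hconv).summable.hasSum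
  have s2 := (hasSum_geomConv_weight hq hcorr).summable.hasSum
  have s3 := (hasSum_geomCorr_weight hq hcorr).summable.hasSum
  have s4 := (hasSum_geomConv_weight hq hlin).summable.hasSum
  have s5 := (hasSum_geomCorr_weight hq hlin).summable.hasSum
  have s6 := (hasSum_geomConv_weight hq hhalf).summable.hasSum
  have s7 := (hasSum_geomCorr_weight hq hhalf).summable.hasSum
  have hL := (s1.sub (s2.mul_left 4)).add (s3.mul_left 4)
  have hR := (s4.sub (s5.mul_left 2)).sub ((s6.sub (s7.mul_left 2)).mul_left 2)
  rw [tsum_mul_geomConv_eq_two_mul_tsum_geomCorr hq] at hR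
  have h4 := two_mul_tsum_geomConv_eq_Z4 hq
  have h2 := two_mul_tsum_geomCorr_eq_Z2_sq hq
  have hterm (n : ℕ+) :
      q ^ (n : ℕ) * (geomConv q n * geomConv q n) -
        4 * (q ^ (n : ℕ) * (geomCorr q n * geomConv q n)) +
        4 * (q ^ (n : ℕ) * (geomCorr q n * geomCorr q n)) =
      q ^ (n : ℕ) * (n * geomInv q n * geomConv q n) -
        2 * (q ^ (n : ℕ) * (n * geomInv q n * geomCorr q n)) -
        2 * (q ^ (n : ℕ) * (geomInv q n * (geomInv q n - 1 / 2) * geomConv q n) -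
          2 * (q ^ (n : ℕ) * (geomInv q n * (geomInv q n - 1 / 2) * geomCorr q n))) := by
    linear_combination q ^ (n : ℕ) * (geomConv q n - 2 * geomCorr q n) *
      geomConv_sub_geomCorr hq n.pos
  have hLR := hL.tsum_eq.symm.trans ((tsum_congr hterm).trans hR.tsum_eq)
  linarith

theorem S_eq (q : ℝ) (hq : |q| < 1) :
    (∑' i : ℕ+, ∑' j : ℕ+, ∑' k : ℕ+, ∑' l : ℕ+, if (i : ℕ) + (j : ℕ) = (k : ℕ) + (l : ℕ) then q ^ ((i : ℕ) + (j : ℕ)) / ((1 - q ^ (i : ℕ)) * (1 - q ^ (j : ℕ)) * (1 - q ^ (k : ℕ)) * (1 - q ^ (l : ℕ))) else 0) = 4 / 3 * (Z2 q) ^ 2 - 1 / 3 * Z4 q + 4 / 3 * (∑' i : ℕ+, ∑' j : ℕ+, ∑' k : ℕ+, q ^ ((i : ℕ) + (j : ℕ) + (k : ℕ)) / ((1 - q ^ (i : ℕ)) * (1 - q ^ (j : ℕ)) * (1 - q ^ (k : ℕ)) * (1 - q ^ ((i : ℕ) + (j : ℕ) + (k : ℕ))))) := by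
  have hs := summable_quadTerm hq
  have hS : ∑' x, quadTerm q x = ∑' (i : ℕ+) (j : ℕ+) (k : ℕ+) (l : ℕ+),
      quadTerm q ((i, j), (k, l)) := by
    rw [hs.tsum_prod, hs.prod.tsum_prod]
    exact tsum_congr fun i => tsum_congr fun j => (hs.prod_factor (i, j)).tsum_prod
  have hconv := tsum_quadTerm_eq_geomConv hq
  have hcorr := tsum_quadTerm_eq_geomCorr hq
  have hsq := tsum_geomConv_sub_sq hq
  rw [tsum_triple_eq hq]
  refine hS.symm.trans ?_
  linarith
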